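/- For all a, b ∈ ℤ and all t ∈ ℕ: λ·f(a,b−1,t) + f(a,b,t) = f(a+1,b+1,t) − f(a+1,b,t). -/

import Mathlib

open Finset

namespace TASEP

attribute [local instance] Classical.propDecidable

noncomputable section

/-- Generalized binomial coefficient `C(n,k) = n(n-1)⋯(n-k+1)/k!` for `n : ℤ`, `k : ℕ`. -/
def C (n : ℤ) (k : ℕ) : ℝ :=
  (∏ i ∈ Finset.range k, ((n : ℝ) - (i : ℝ))) / (k.factorial : ℝ)

/-- `λ = v/(1-v)`. -/
def lam (v : ℝ) : ℝ := v / (1 - v)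

/-- The matrix element `f(a,b,t)` of the determinant solution of the parallel TASEP. -/
def f (v : ℝ) (a b : ℤ) (t : ℕ) : ℝ :=
  if 1 ≤ a then
    (1 - v) ^ t * (-1 : ℝ) ^ a *
      ∑' k : ℕ, if 0 ≤ b + (k : ℤ) then
        C ((t : ℤ) + a) (b + (k : ℤ)).toNat * C (a + (k : ℤ) - 1) k *
          lam v ^ (b + (k : ℤ)).toNat
      else 0
  else
    (1 - v) ^ t * (-1 : ℝ) ^ a *
      ∑' j : ℕ, if (j : ℤ) ≤ -a ∧ 0 ≤ b + (j : ℤ) then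
        (-1 : ℝ) ^ j * C (-a) j * C ((t : ℤ) + a) (b + (j : ℤ)).toNat *
          lam v ^ (b + (j : ℤ)).toNat
      else 0

/-- Number of pairs of neighboring particles (occupied neighboring sites) in `x`. -/
def nPairs {P : ℕ} (x : Fin P → ℤ) : ℕ :=
  (Finset.univ.filter fun p : Fin P × Fin P =>
    ((p.2 : ℕ) = (p.1 : ℕ) + 1) ∧ x p.2 = x p.1 + 1).card

/-- Number of clusters `N_c(x) = P - nPairs x`. -/
def Nc {P : ℕ} (x : Fin P → ℤ) : ℕ := P - nPairs x

/-- The matrix `F(X,Y,t)` with entries `f(i-j, x_i - y_j, t)`. -/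
def Fmat (v : ℝ) {P : ℕ} (x y : Fin P → ℤ) (t : ℕ) : Matrix (Fin P) (Fin P) ℝ :=
  Matrix.of fun i j => f v ((i : ℤ) - (j : ℤ)) (x i - y j) t

/-- One-step transition probability of the parallel-update TASEP. -/
def Tstep (v : ℝ) {P : ℕ} (x x' : Fin P → ℤ) : ℝ :=
  ∏ i : Fin P,
    if x i = x' i + 1 ∧ (∀ j : Fin P, (j : ℕ) = (i : ℕ) + 1 → x' i + 1 < x' j) then v
    else if x i = x' i ∧ (∀ j : Fin P, (j : ℕ) = (i : ℕ) + 1 → x' i + 1 < x' j) then 1 - v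
    else if x i = x' i ∧ (∃ j : Fin P, (j : ℕ) = (i : ℕ) + 1 ∧ x' j = x' i + 1) then 1
    else 0

/-- Transformed transition probability `T₀(X,X') = (1-v)^(N_c(X)-N_c(X')) T(X,X')`. -/
def T0 (v : ℝ) {P : ℕ} (x x' : Fin P → ℤ) : ℝ :=
  (1 - v) ^ ((Nc x : ℤ) - (Nc x' : ℤ)) * Tstep v x x'

/-- `shiftBy x k` subtracts `1` from the coordinates selected by `k`. -/
def shiftBy {P : ℕ} (x : Fin P → ℤ) (k : Fin P → Bool) : Fin P → ℤ :=
  fun i => x i - if k i then 1 else 0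

/-- `t`-step probability of the parallel-update TASEP started from `x0`. -/
def Pt (v : ℝ) {P : ℕ} (x0 : Fin P → ℤ) : ℕ → (Fin P → ℤ) → ℝ
  | 0 => fun x => if x = x0 then 1 else 0
  | t + 1 => fun x => ∑ k : Fin P → Bool,
      if StrictMono (shiftBy x k) then
        Tstep v x (shiftBy x k) * Pt v x0 t (shiftBy x k)
      else 0

/-- One-particle weight `F₀(x|t)`. -/
def F0 (v : ℝ) (x : ℤ) (t : ℕ) : ℝ :=
  if 0 ≤ x ∧ x ≤ (t : ℤ) then (t.choose x.toNat : ℝ) * v ^ x.toNat * (1 - v) ^ (t - x.toNat)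
  else 0

/-- Schütz's functions `F_m(N|t)` for the backward sequential update. -/
def Fm (v : ℝ) (m : ℤ) (N : ℤ) (t : ℕ) : ℝ :=
  if 0 < m then
    ∑' k : ℕ, ((k + m.toNat - 1).choose (m.toNat - 1) : ℝ) * F0 v (N + (k : ℤ)) t
  else if m = 0 then F0 v N t
  else
    ∑ k ∈ Finset.range (m.natAbs + 1),
      (-1 : ℝ) ^ k * (m.natAbs.choose k : ℝ) * F0 v (N + (k : ℤ)) t

/-- The functions `F̃_m(N|t)` for the parallel update. -/
def Ftil (v : ℝ) (m : ℤ) (N : ℤ) (t : ℕ) : ℝ :=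
  if 0 < m then
    ∑ n ∈ Finset.range (m.toNat + 1),
      ∑' k : ℤ, if -(n : ℤ) ≤ k then
        (m.toNat.choose n : ℝ) * ((m + (n : ℤ) + k - 1).toNat.choose ((n : ℤ) + k).toNat : ℝ) *
          lam v ^ n * F0 v (N + k) t
      else 0
  else if m = 0 then F0 v N t
  else
    ∑ n ∈ Finset.range (m.natAbs + 1),
      ∑' k : ℤ, if -(n : ℤ) ≤ k then
        (-1 : ℝ) ^ n * (m.natAbs.choose n : ℝ) *
          (((m.natAbs : ℤ) + (n : ℤ) + k - 1).toNat.choose ((n : ℤ) + k).toNat : ℝ) *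
          (-(lam v)) ^ ((n : ℤ) + k).toNat * F0 v (N - k) t
      else 0

/-- One-step transition probability of the TASEP with backward sequential update. -/
def TBw (v : ℝ) {P : ℕ} (x x' : Fin P → ℤ) : ℝ :=
  ∏ i : Fin P,
    if h : (i : ℕ) + 1 < P then
      if x' i + 1 < x' ⟨(i : ℕ) + 1, h⟩ ∨
          (x' ⟨(i : ℕ) + 1, h⟩ = x' i + 1 ∧ x ⟨(i : ℕ) + 1, h⟩ = x' ⟨(i : ℕ) + 1, h⟩ + 1) then
        (if x i = x' i + 1 then v else if x i = x' i then 1 - v else 0)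
      else if x' ⟨(i : ℕ) + 1, h⟩ = x' i + 1 ∧ x ⟨(i : ℕ) + 1, h⟩ = x' ⟨(i : ℕ) + 1, h⟩ then
        (if x i = x' i then 1 else 0)
      else 0
    else
      (if x i = x' i + 1 then v else if x i = x' i then 1 - v else 0)

/-- `t`-step probability of the backward-sequential-update TASEP started from `x0`. -/
def Pbw (v : ℝ) {P : ℕ} (x0 : Fin P → ℤ) : ℕ → (Fin P → ℤ) → ℝ
  | 0 => fun x => if x = x0 then 1 else 0
  | t + 1 => fun x => ∑ k : Fin P → Bool,
      if StrictMono (shiftBy x k) then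
        TBw v x (shiftBy x k) * Pbw v x0 t (shiftBy x k)
      else 0

/-- Reversed-negated configuration `ι(X)_i = -x_{P+1-i}`. -/
def iota {P : ℕ} (x : Fin P → ℤ) : Fin P → ℤ := fun i => - x i.rev

/-- `i` is a cluster head of `x` (first particle of a cluster). -/
def isHead {P : ℕ} (x : Fin P → ℤ) (i : Fin P) : Prop :=
  ∀ j : Fin P, (i : ℕ) = (j : ℕ) + 1 → x j + 1 < x i

/-- Position of the `i`-th walker at time `s`, given steps `ε`. -/
def walkerPos {P t : ℕ} (x0 : Fin P → ℤ) (ε : Fin P → Fin t → Bool) (i : Fin P) (s : ℕ) : ℤ :=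
  x0 i + ((Finset.univ.filter fun u : Fin t => (u : ℕ) < s ∧ ε i u = true).card : ℤ)

/-- General Bethe-ansatz sum with amplitudes `A`. -/
def betheSum {P : ℕ} (z : Fin P → ℂ) (A : Equiv.Perm (Fin P) → ℂ) (x : Fin P → ℤ) : ℂ :=
  ∑ σ : Equiv.Perm (Fin P), A σ * ∏ i : Fin P, z (σ i) ^ (-(x i))

/-- `ξ(z) = -(1+λz)/(1-1/z)`. -/
def xiC (v : ℝ) (z : ℂ) : ℂ := -(1 + (lam v : ℂ) * z) / (1 - 1 / z)

/-- Bethe amplitudes `A_σ = sgn(σ) ∏ ξ_{σ(i)}^{i-σ(i)}`. -/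
def ampA (v : ℝ) {P : ℕ} (z : Fin P → ℂ) (σ : Equiv.Perm (Fin P)) : ℂ :=
  ((Equiv.Perm.sign σ : ℤ) : ℂ) * ∏ i : Fin P, xiC v (z (σ i)) ^ ((i : ℤ) - (σ i : ℤ))

/-- The Bethe eigenfunction `B(x)`. -/
def betheB (v : ℝ) {P : ℕ} (z : Fin P → ℂ) (x : Fin P → ℤ) : ℂ :=
  betheSum z (ampA v z) x


theorem C_zero_right (n : ℤ) : C n 0 = 1 := by simp [C]

theorem C_add_one_succ (n : ℤ) (k : ℕ) : C (n + 1) (k + 1) = C n (k + 1) + C n k := by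
  have hk : (k.factorial : ℝ) ≠ 0 := by positivity
  have hk1 : (k : ℝ) + 1 ≠ 0 := by positivity
  have hprod : ∏ i ∈ range k, (((n + 1 : ℤ) : ℝ) - ((i + 1 : ℕ) : ℝ)) =
      ∏ i ∈ range k, ((n : ℝ) - i) :=
    prod_congr rfl fun i _ => by push_cast; ring
  simp only [C]
  rw [prod_range_succ', hprod, prod_range_succ, Nat.factorial_succ]
  push_cast
  field_simp
  ring

theorem C_eq_zero_of_lt {n : ℤ} (hn : 0 ≤ n) {k : ℕ} (hk : n < k) : C n k = 0 := by
  lift n to ℕ using hn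
  rw [C, prod_eq_zero (mem_range.2 (Nat.cast_lt.1 hk)) (by simp), zero_div]

theorem C_add_sub_one (a : ℤ) (k : ℕ) : C (a + k - 1) k = (-1) ^ k * C (-a) k := by
  rw [C, C, ← mul_div_assoc, ← prod_range_reflect]
  congr 1
  rw [← card_range k, ← prod_const, card_range, ← prod_mul_distrib]
  refine prod_congr rfl fun i hi => ?_
  have hi := mem_range.1 hi
  rw [Nat.cast_sub (by omega), Nat.cast_sub (by omega)]
  push_cast
  ring

/-- The `m`-th coefficient of `(1 + x z) ^ n`, extended by zero to negative `m`. -/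
def binomTerm (x : ℝ) (n m : ℤ) : ℝ :=
  if 0 ≤ m then C n m.toNat * x ^ m.toNat else 0

theorem binomTerm_add_one (x : ℝ) (n m : ℤ) :
    binomTerm x (n + 1) m = x * binomTerm x n (m - 1) + binomTerm x n m := by
  rcases lt_trichotomy m 0 with h | rfl | h
  · simp [binomTerm, h.not_ge, show ¬ (1 ≤ m) by omega]
  · simp [binomTerm, C_zero_right]
  · obtain ⟨k, rfl⟩ : ∃ k : ℕ, m = (k : ℤ) + 1 := ⟨(m - 1).toNat, by omega⟩
    have h1 : ((k : ℤ) + 1).toNat = k + 1 := by omega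
    simp only [binomTerm, if_pos h.le, add_sub_cancel_right, if_pos (Int.natCast_nonneg k), h1,
      Int.toNat_natCast, C_add_one_succ]
    ring

/-- The `k`-th coefficient of `(1 - z) ^ (-a)`. -/
def binomWeight (a : ℤ) (k : ℕ) : ℝ := (-1) ^ k * C (-a) k

theorem binomWeight_zero (a : ℤ) : binomWeight a 0 = 1 := by simp [binomWeight, C_zero_right]

theorem binomWeight_succ (a : ℤ) (k : ℕ) :
    binomWeight a (k + 1) = binomWeight (a + 1) (k + 1) - binomWeight (a + 1) k := by
  have h := C_add_one_succ (-(a + 1)) k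
  rw [show -(a + 1) + 1 = -a by ring] at h
  rw [binomWeight, binomWeight, binomWeight, h]
  ring

theorem f_eq_tsum (v : ℝ) (a b : ℤ) (t : ℕ) :
    f v a b t = (1 - v) ^ t * (-1 : ℝ) ^ a *
      ∑' k : ℕ, binomWeight a k * binomTerm (lam v) (t + a) (b + k) := by
  unfold f
  split_ifs with ha
  · congr 2
    ext k
    rw [C_add_sub_one, binomTerm, binomWeight]
    split_ifs <;> ring
  · congr 2
    ext k
    rw [binomTerm, binomWeight]
    by_cases hk : (k : ℤ) ≤ -a
    · simp only [hk, true_and]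
      split_ifs <;> ring
    · rw [if_neg (fun h => hk h.1), C_eq_zero_of_lt (by omega) (not_le.1 hk)]
      ring

theorem summable_binomWeight_mul_binomTerm (x : ℝ) {a n : ℤ} (h : a ≤ 0 ∨ 0 ≤ n) (b : ℤ) :
    Summable fun k : ℕ => binomWeight a k * binomTerm x n (b + k) := by
  rcases h with h | h
  · refine summable_of_ne_finset_zero (s := range ((-a).toNat + 1)) fun k hk => ?_
    have hk := mem_range.not.1 hk
    rw [binomWeight, C_eq_zero_of_lt (by omega) (by omega), mul_zero, zero_mul]
  · refine summable_of_ne_finset_zero (s := range ((n - b).toNat + 1)) fun k hk => ?_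
    have hk := mem_range.not.1 hk
    rw [binomTerm, if_pos (by omega), C_eq_zero_of_lt h (by omega), zero_mul, mul_zero]

theorem tsum_binomWeight_mul {a : ℤ} {h : ℕ → ℝ}
    (h₀ : Summable fun k => binomWeight (a + 1) k * h k)
    (h₁ : Summable fun k => binomWeight (a + 1) k * h (k + 1)) :
    ∑' k, binomWeight a k * h k =
      ∑' k, binomWeight (a + 1) k * h k - ∑' k, binomWeight (a + 1) k * h (k + 1) := by
  have h₂ := (summable_nat_add_iff 1).2 h₀
  have key : ∀ k, binomWeight a (k + 1) * h (k + 1) =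
      binomWeight (a + 1) (k + 1) * h (k + 1) - binomWeight (a + 1) k * h (k + 1) := fun k => by
    rw [binomWeight_succ, sub_mul]
  have hs : Summable fun k => binomWeight a k * h k :=
    (summable_nat_add_iff 1).1 ((h₂.sub h₁).congr fun k => (key k).symm)
  rw [hs.tsum_eq_zero_add, h₀.tsum_eq_zero_add, tsum_congr key, h₂.tsum_sub h₁,
    binomWeight_zero, binomWeight_zero]
  ring

/-- Shift identity: `λ f(a,b-1,t) + f(a,b,t) = f(a+1,b+1,t) - f(a+1,b,t)`. -/
theorem f_shift_identity (v : ℝ) (hv0 : 0 < v) (hv1 : v < 1) (a b : ℤ) (t : ℕ) :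
    lam v * f v a (b - 1) t + f v a b t = f v (a + 1) (b + 1) t - f v (a + 1) b t := by
  have hn : a ≤ 0 ∨ 0 ≤ (t : ℤ) + a := by omega
  have hn' : a + 1 ≤ 0 ∨ 0 ≤ (t : ℤ) + (a + 1) := by omega
  have hshift : ∀ k : ℕ, b + 1 + (k : ℤ) = b + ((k + 1 : ℕ) : ℤ) := fun k => by push_cast; ring
  have hsum := summable_binomWeight_mul_binomTerm (lam v) hn' (b + 1)
  have hpascal : ∑' k : ℕ, binomWeight a k * binomTerm (lam v) (t + (a + 1)) (b + k) =
      lam v * ∑' k : ℕ, binomWeight a k * binomTerm (lam v) (t + a) (b - 1 + k) +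
        ∑' k : ℕ, binomWeight a k * binomTerm (lam v) (t + a) (b + k) := by
    rw [← tsum_mul_left, ← ((summable_binomWeight_mul_binomTerm (lam v) hn (b - 1)).mul_left
      (lam v)).tsum_add (summable_binomWeight_mul_binomTerm (lam v) hn b)]
    refine tsum_congr fun k => ?_
    rw [← add_assoc, binomTerm_add_one, sub_add_eq_add_sub]
    ring
  simp only [hshift] at hsum
  rw [tsum_binomWeight_mul (summable_binomWeight_mul_binomTerm (lam v) hn' b) hsum] at hpascal
  simp only [f_eq_tsum, hshift]
  rw [zpow_add_one₀ (by norm_num)]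
  linear_combination -((1 - v) ^ t * (-1 : ℝ) ^ a) * hpascal

end

end TASEP
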